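/- arXiv:2509.02405 — 2 statements merged into one kernel-verified Lean document; each statement's English description precedes it below -/
import Mathlib

section
/- Let m ∈ ℕ with m ≥ 1, let 1 ≤ p_1 < p_2 < ⋯ < p_m < ∞ be real numbers, and let X = ℓ_{p_1} ⊕ ℓ_{p_2} ⊕ ⋯ ⊕ ℓ_{p_m} be their direct sum, normed by ‖(x_1,…,x_m)‖ = max_j ‖x_j‖. Then for any strictly singular bounded linear operators T_1, …, T_m : X → X, the composition T_m ∘ T_{m-1} ∘ ⋯ ∘ T_1 is compact. -/
/-- A bounded linear operator `T : E → F` between normed spaces is *strictly singular* if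
for every infinite-dimensional subspace `M` of `E` and every `c > 0` there exists `x ∈ M`
with `‖T x‖ < c * ‖x‖`. -/
def StrictlySingular {E F : Type*} [NormedAddCommGroup E] [NormedSpace ℝ E]
    [NormedAddCommGroup F] [NormedSpace ℝ F] (T : E →L[ℝ] F) : Prop :=
  ∀ M : Submodule ℝ E, ¬ FiniteDimensional ℝ M → ∀ c : ℝ, 0 < c → ∃ x ∈ M, ‖T x‖ < c * ‖x‖

open Filter Topology
open scoped ENNReal

theorem lp.norm_sum_rpow_of_disjoint {ι : Type*} {p : ℝ≥0∞} (hp : 0 < p.toReal)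
    {f : ι → lp (fun _ : ℕ => ℝ) p} (hf : ∀ k l, k ≠ l → ∀ i, f k i = 0 ∨ f l i = 0)
    (s : Finset ι) :
    ‖∑ k ∈ s, f k‖ ^ p.toReal = ∑ k ∈ s, ‖f k‖ ^ p.toReal := by
  refine (lp.hasSum_norm hp _).unique ?_
  convert! hasSum_sum (fun k (_ : k ∈ s) => lp.hasSum_norm hp (f k)) using 2 with i
  rw [lp.coeFn_sum, Finset.sum_apply]
  by_cases h : ∃ k ∈ s, f k i ≠ 0
  · obtain ⟨k, hk, hki⟩ := h
    have h0 : ∀ l ∈ s, l ≠ k → f l i = 0 := fun l _ hl => (hf l k hl i).resolve_right hki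
    rw [Finset.sum_eq_single_of_mem k hk h0, Finset.sum_eq_single_of_mem k hk]
    intro l hl hlk
    rw [h0 l hl hlk, _root_.norm_zero, Real.zero_rpow hp.ne']
  · push Not at h
    rw [Finset.sum_eq_zero h, Finset.sum_eq_zero, _root_.norm_zero, Real.zero_rpow hp.ne']
    intro l hl
    rw [h l hl, _root_.norm_zero, Real.zero_rpow hp.ne']

theorem lp.norm_sum_smul_of_disjoint {ι : Type*} {p : ℝ≥0∞} [Fact (1 ≤ p)]
    (hp : 0 < p.toReal)
    {f : ι → lp (fun _ : ℕ => ℝ) p} (hf : ∀ k l, k ≠ l → ∀ i, f k i = 0 ∨ f l i = 0)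
    (s : Finset ι) (a : ι → ℝ) :
    ‖∑ k ∈ s, a k • f k‖ ^ p.toReal = ∑ k ∈ s, |a k| ^ p.toReal * ‖f k‖ ^ p.toReal := by
  have hf' : ∀ k l, k ≠ l → ∀ i, (a k • f k) i = 0 ∨ (a l • f l) i = 0 := fun k l hkl i =>
    (hf k l hkl i).imp (fun h => by simp [h]) (fun h => by simp [h])
  rw [lp.norm_sum_rpow_of_disjoint hp hf']
  refine Finset.sum_congr rfl fun k _ => ?_
  rw [norm_smul, Real.norm_eq_abs, Real.mul_rpow (abs_nonneg _) (norm_nonneg _)]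

theorem Finset.abs_le_rpow_sum_rpow {ι : Type*} {r : ℝ} (hr : 0 < r) (s : Finset ι) (a : ι → ℝ)
    {k : ι} (hk : k ∈ s) : |a k| ≤ (∑ k ∈ s, |a k| ^ r) ^ r⁻¹ := by
  rw [Real.le_rpow_inv_iff_of_pos (abs_nonneg _) (by positivity) hr]
  exact Finset.single_le_sum (f := fun k => |a k| ^ r) (fun _ _ => by positivity) hk

theorem Finset.rpow_sum_rpow_antitone {ι : Type*} {q p : ℝ} (hq : 0 < q) (hqp : q ≤ p)
    (s : Finset ι) (a : ι → ℝ) :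
    (∑ k ∈ s, |a k| ^ p) ^ p⁻¹ ≤ (∑ k ∈ s, |a k| ^ q) ^ q⁻¹ := by
  have hp : 0 < p := hq.trans_le hqp
  set A := (∑ k ∈ s, |a k| ^ q) ^ q⁻¹ with hA
  have hA0 : 0 ≤ A := by positivity
  have hAq : ∑ k ∈ s, |a k| ^ q = A ^ q := by
    rw [hA, Real.rpow_inv_rpow (by positivity) hq.ne']
  rw [Real.rpow_inv_le_iff_of_pos (by positivity) hA0 hp]
  calc ∑ k ∈ s, |a k| ^ p ≤ ∑ k ∈ s, A ^ (p - q) * |a k| ^ q := by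
        refine Finset.sum_le_sum fun k hk => ?_
        have h := Finset.abs_le_rpow_sum_rpow hq s a hk
        have h2 : |a k| ^ p = |a k| ^ (p - q) * |a k| ^ q := by
          rw [← Real.rpow_add_of_nonneg (abs_nonneg _) (by linarith) hq.le, sub_add_cancel]
        rw [h2]
        gcongr
    _ = A ^ p := by
        rw [← Finset.mul_sum, hAq, ← Real.rpow_add_of_nonneg hA0 (by linarith) hq.le,
          sub_add_cancel]

theorem norm_sum_smul_sub_le {E ι : Type*} [NormedAddCommGroup E] [NormedSpace ℝ E]
    {r : ℝ} (hr : 0 < r) {y u : ι → E} {e : ι → ℝ} {ε : ℝ} (s : Finset ι) (a : ι → ℝ)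
    (hyu : ∀ k, ‖y k - u k‖ ≤ e k) (he : ∑ k ∈ s, e k ≤ ε) :
    ‖∑ k ∈ s, a k • y k - ∑ k ∈ s, a k • u k‖ ≤ ε * (∑ k ∈ s, |a k| ^ r) ^ r⁻¹ := by
  rw [← Finset.sum_sub_distrib]
  calc ‖∑ k ∈ s, (a k • y k - a k • u k)‖ ≤ ∑ k ∈ s, ‖a k • y k - a k • u k‖ := norm_sum_le _ _
    _ ≤ ∑ k ∈ s, (∑ k ∈ s, |a k| ^ r) ^ r⁻¹ * e k := by
        refine Finset.sum_le_sum fun k hk => ?_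
        rw [← smul_sub, norm_smul, Real.norm_eq_abs]
        exact mul_le_mul (Finset.abs_le_rpow_sum_rpow hr s a hk) (hyu k) (norm_nonneg _)
          (by positivity)
    _ ≤ ε * (∑ k ∈ s, |a k| ^ r) ^ r⁻¹ := by
        rw [← Finset.mul_sum, mul_comm]
        gcongr

theorem lp.norm_sum_smul_le_of_disjoint {ι : Type*} {p : ℝ≥0∞} [Fact (1 ≤ p)]
    (hp : 0 < p.toReal)
    {u : ι → lp (fun _ : ℕ => ℝ) p} (hu : ∀ k l, k ≠ l → ∀ i, u k i = 0 ∨ u l i = 0)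
    {C : ℝ} (hC : 0 ≤ C) (huC : ∀ k, ‖u k‖ ≤ C) (s : Finset ι) (a : ι → ℝ) :
    ‖∑ k ∈ s, a k • u k‖ ≤ C * (∑ k ∈ s, |a k| ^ p.toReal) ^ p.toReal⁻¹ := by
  rw [← Real.rpow_le_rpow_iff (norm_nonneg _) (by positivity) hp,
    lp.norm_sum_smul_of_disjoint hp hu, Real.mul_rpow hC (by positivity),
    Real.rpow_inv_rpow (by positivity) hp.ne', mul_comm, Finset.sum_mul]
  gcongr
  exact huC _

theorem lp.le_norm_sum_smul_of_disjoint {ι : Type*} {p : ℝ≥0∞} [Fact (1 ≤ p)]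
    (hp : 0 < p.toReal)
    {u : ι → lp (fun _ : ℕ => ℝ) p} (hu : ∀ k l, k ≠ l → ∀ i, u k i = 0 ∨ u l i = 0)
    {c : ℝ} (hc : 0 ≤ c) (huc : ∀ k, c ≤ ‖u k‖) (s : Finset ι) (a : ι → ℝ) :
    c * (∑ k ∈ s, |a k| ^ p.toReal) ^ p.toReal⁻¹ ≤ ‖∑ k ∈ s, a k • u k‖ := by
  rw [← Real.rpow_le_rpow_iff (by positivity) (norm_nonneg _) hp,
    lp.norm_sum_smul_of_disjoint hp hu, Real.mul_rpow hc (by positivity),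
    Real.rpow_inv_rpow (by positivity) hp.ne', mul_comm, Finset.sum_mul]
  gcongr
  exact huc _

/-- The restriction of `f` to the finite set `s` of coordinates. -/
noncomputable def lp.truncate {p : ℝ≥0∞} (s : Finset ℕ) (f : lp (fun _ : ℕ => ℝ) p) :
    lp (fun _ : ℕ => ℝ) p := ∑ i ∈ s, lp.single p i (f i)

theorem lp.truncate_apply {p : ℝ≥0∞} (s : Finset ℕ) (f : lp (fun _ : ℕ => ℝ) p) (j : ℕ) :
    lp.truncate s f j = if j ∈ s then f j else 0 := by
  rw [lp.truncate, lp.coeFn_sum, Finset.sum_apply]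
  simp only [lp.single_apply, Finset.sum_pi_single]

theorem lp.norm_truncate_le {p : ℝ≥0∞} [Fact (1 ≤ p)] (hp : 0 < p.toReal) (s : Finset ℕ)
    (f : lp (fun _ : ℕ => ℝ) p) : ‖lp.truncate s f‖ ≤ ‖f‖ := by
  rw [← Real.rpow_le_rpow_iff (norm_nonneg _) (norm_nonneg _) hp, lp.truncate,
    lp.norm_sum_single hp]
  exact lp.sum_rpow_le_norm_rpow hp f s

theorem lp.tendsto_truncate_range {p : ℝ≥0∞} [Fact (1 ≤ p)] (hp : p ≠ ⊤)
    (f : lp (fun _ : ℕ => ℝ) p) :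
    Tendsto (fun n => lp.truncate (Finset.range n) f) atTop (𝓝 f) :=
  (lp.hasSum_single hp f).tendsto_sum_nat

theorem lp.truncate_tendsto_zero {p : ℝ≥0∞} [Fact (1 ≤ p)]
    {y : ℕ → lp (fun _ : ℕ => ℝ) p} (hy : ∀ i, Tendsto (fun n => y n i) atTop (𝓝 0))
    (s : Finset ℕ) : Tendsto (fun n => lp.truncate s (y n)) atTop (𝓝 0) := by
  rw [← Finset.sum_const_zero (s := s)]
  refine tendsto_finsetSum _ fun i _ => ?_
  have h := ((lp.isometry_single (E := fun _ : ℕ => ℝ) (p := p) i).continuous.tendsto 0).comp (hy i)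
  rwa [lp.single_zero] at h

theorem lp.exists_norm_sub_truncate_lt {p : ℝ≥0∞} [Fact (1 ≤ p)] (hp : p ≠ ⊤)
    {y : ℕ → lp (fun _ : ℕ => ℝ) p} (hy : ∀ i, Tendsto (fun n => y n i) atTop (𝓝 0))
    (N : ℕ) {ε : ℝ} (hε : 0 < ε) :
    ∀ᶠ n in atTop, ∀ᶠ N' in atTop, ‖y n - lp.truncate (Finset.Ico N N') (y n)‖ < ε := by
  have h1 : ∀ᶠ n in atTop, ‖lp.truncate (Finset.range N) (y n)‖ < ε / 2 :=
    (lp.truncate_tendsto_zero hy _).norm.eventually_lt_const (by simpa using hε)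
  filter_upwards [h1] with n hn
  have h2 := (Metric.tendsto_nhds.1 (lp.tendsto_truncate_range hp (y n))) (ε / 2) (by positivity)
  filter_upwards [h2, eventually_ge_atTop N] with N' hN' hNN'
  have h3 : lp.truncate (Finset.Ico N N') (y n) =
      lp.truncate (Finset.range N') (y n) - lp.truncate (Finset.range N) (y n) :=
    Finset.sum_Ico_eq_sub _ hNN'
  rw [dist_comm, dist_eq_norm] at hN'
  rw [h3, sub_sub_eq_add_sub, add_sub_right_comm]
  exact (norm_add_le _ _).trans_lt (by linarith)

theorem lp.truncate_Ico_disjoint {p : ℝ≥0∞} {N : ℕ → ℕ} (hN : Monotone N)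
    (y : ℕ → lp (fun _ : ℕ => ℝ) p) (k l : ℕ) (hkl : k ≠ l) (i : ℕ) :
    lp.truncate (Finset.Ico (N k) (N (k + 1))) (y k) i = 0 ∨
      lp.truncate (Finset.Ico (N l) (N (l + 1))) (y l) i = 0 := by
  rw [lp.truncate_apply, lp.truncate_apply]
  by_contra! h
  have h1 : i ∈ Finset.Ico (N k) (N (k + 1)) := by by_contra h'; simp [h'] at h
  have h2 : i ∈ Finset.Ico (N l) (N (l + 1)) := by by_contra h'; simp [h'] at h
  rw [Finset.mem_Ico] at h1 h2
  rcases lt_or_gt_of_ne hkl with h3 | h3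
  · exact absurd (hN (Nat.succ_le_of_lt h3)) (by simp only [Nat.succ_eq_add_one]; omega)
  · exact absurd (hN (Nat.succ_le_of_lt h3)) (by simp only [Nat.succ_eq_add_one]; omega)

/-- The gliding hump argument: coordinatewise null sequences in `ℓ_p` and `ℓ_q` have simultaneous
subsequences close to block sequences. -/
theorem lp.exists_blocks {p q : ℝ≥0∞} [Fact (1 ≤ p)] [Fact (1 ≤ q)] (hp : p ≠ ⊤) (hq : q ≠ ⊤)
    {y : ℕ → lp (fun _ : ℕ => ℝ) p} {z : ℕ → lp (fun _ : ℕ => ℝ) q}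
    (hy : ∀ i, Tendsto (fun n => y n i) atTop (𝓝 0))
    (hz : ∀ i, Tendsto (fun n => z n i) atTop (𝓝 0))
    {e : ℕ → ℝ} (he : ∀ k, 0 < e k) :
    ∃ (φ N : ℕ → ℕ), Monotone N ∧
      (∀ k, ‖y (φ k) - lp.truncate (Finset.Ico (N k) (N (k + 1))) (y (φ k))‖ ≤ e k) ∧
      ∀ k, ‖z (φ k) - lp.truncate (Finset.Ico (N k) (N (k + 1))) (z (φ k))‖ ≤ e k := by
  have h : ∀ k N, ∃ n N', N ≤ N' ∧ ‖y n - lp.truncate (Finset.Ico N N') (y n)‖ < e k ∧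
      ‖z n - lp.truncate (Finset.Ico N N') (z n)‖ < e k := by
    intro k N
    obtain ⟨n, h1, h2⟩ := ((lp.exists_norm_sub_truncate_lt hp hy N (he k)).and
      (lp.exists_norm_sub_truncate_lt hq hz N (he k))).exists
    obtain ⟨N', h3, h4, h5⟩ := ((eventually_ge_atTop N).and (h1.and h2)).exists
    exact ⟨n, N', h3, h4, h5⟩
  choose n N' h1 h2 h3 using h
  let N : ℕ → ℕ := fun k => Nat.rec 0 (fun k M => N' k M) k
  exact ⟨fun k => n k (N k), N, monotone_nat_of_le_succ fun k => h1 k (N k),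
    fun k => (h2 k (N k)).le, fun k => (h3 k (N k)).le⟩

theorem StrictlySingular.false_of_bounded_below {E F : Type*} [NormedAddCommGroup E]
    [NormedSpace ℝ E] [NormedAddCommGroup F] [NormedSpace ℝ F] {T : E →L[ℝ] F}
    (hT : StrictlySingular T) {y : ℕ → E} {A : (ℕ →₀ ℝ) → ℝ} {c C : ℝ} (hc : 0 < c) (hC : 0 < C)
    (hA : ∀ a, A a ≤ 0 → a = 0)
    (hup : ∀ a : ℕ →₀ ℝ, ‖∑ k ∈ a.support, a k • y k‖ ≤ C * A a)
    (hlow : ∀ a : ℕ →₀ ℝ, c * A a ≤ ‖∑ k ∈ a.support, a k • T (y k)‖) : False := by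
  have hlow' : ∀ a : ℕ →₀ ℝ, c * A a ≤ ‖T (Finsupp.linearCombination ℝ y a)‖ := fun a => by
    simpa [Finsupp.linearCombination_apply, Finsupp.sum] using hlow a
  have hli : LinearIndependent ℝ y := by
    rw [linearIndependent_iff]
    intro a ha
    have h := hlow' a
    rw [ha, map_zero, norm_zero] at h
    exact hA a (by nlinarith)
  obtain ⟨x, hx, hlt⟩ := hT (Submodule.span ℝ (Set.range y))
    (fun hfd => Set.infinite_univ (α := ℕ) (Set.finite_univ_iff.2
      ((linearIndependent_span hli).finite))) (c / C) (by positivity)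
  obtain ⟨a, rfl⟩ := (Finsupp.mem_span_range_iff_exists_finsupp).1 hx
  have h1 := hup a
  have h2 := hlow' a
  rw [Finsupp.linearCombination_apply] at h2
  have h3 : c / C * ‖a.sum fun i c => c • y i‖ ≤ c * A a := by
    rw [div_mul_eq_mul_div, div_le_iff₀ hC]
    calc _ ≤ c * (C * A a) := mul_le_mul_of_nonneg_left h1 hc.le
      _ = _ := by ring
  linarith

theorem StrictlySingular.not_coordinatewise_null {p q : ℝ≥0∞} [Fact (1 ≤ p)] [Fact (1 ≤ q)]
    (hp : p ≠ ⊤) (hqp : q ≤ p)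
    {T : lp (fun _ : ℕ => ℝ) p →L[ℝ] lp (fun _ : ℕ => ℝ) q} (hT : StrictlySingular T)
    {y : ℕ → lp (fun _ : ℕ => ℝ) p} {C δ : ℝ} (hδ : 0 < δ)
    (hyC : ∀ n, ‖y n‖ ≤ C) (hTy : ∀ n, δ ≤ ‖T (y n)‖)
    (hy : ∀ i, Tendsto (fun n => y n i) atTop (𝓝 0))
    (hz : ∀ i, Tendsto (fun n => T (y n) i) atTop (𝓝 0)) : False := by
  have hq : q ≠ ⊤ := ne_top_of_le_ne_top hp hqp
  have hq0 : 0 < q.toReal := ENNReal.toReal_pos (zero_lt_one.trans_le Fact.out).ne' hq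
  have hp0 : 0 < p.toReal := ENNReal.toReal_pos (zero_lt_one.trans_le Fact.out).ne' hp
  have hC : 0 ≤ C := (norm_nonneg _).trans (hyC 0)
  obtain ⟨e, he, c, hc, hce⟩ := posSumOfEncodable (ε := δ / 4) (by positivity) ℕ
  have hes : ∀ s : Finset ℕ, ∑ k ∈ s, e k ≤ δ / 4 := fun s =>
    (sum_le_hasSum s (fun k _ => (he k).le) hc).trans hce
  have hek : ∀ k, e k ≤ δ / 4 := fun k => by simpa using hes {k}
  obtain ⟨φ, N, hN, hu, hw⟩ := lp.exists_blocks hp hq hy hz he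
  have hwδ : ∀ k, 3 * δ / 4 ≤
      ‖lp.truncate (Finset.Ico (N k) (N (k + 1))) (T (y (φ k)))‖ := fun k => by
    have h1 := norm_sub_norm_le (T (y (φ k))) (lp.truncate (Finset.Ico (N k) (N (k + 1)))
      (T (y (φ k))))
    linarith [hw k, hek k, hTy (φ k)]
  refine hT.false_of_bounded_below (y := y ∘ φ) (c := δ / 2) (C := C + δ / 4)
    (A := fun a => (∑ k ∈ a.support, |a k| ^ p.toReal) ^ p.toReal⁻¹) (by positivity)
    (by positivity) (fun a ha => ?_) (fun a => ?_) (fun a => ?_)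
  · ext k
    by_contra hk
    have h := Finset.abs_le_rpow_sum_rpow hp0 a.support a (Finsupp.mem_support_iff.2 hk)
    exact hk (abs_nonpos_iff.1 (h.trans ha))
  · have h1 := norm_sum_smul_sub_le hp0 a.support a hu (hes _)
    have h2 := lp.norm_sum_smul_le_of_disjoint hp0
      (lp.truncate_Ico_disjoint hN (y ∘ φ)) hC
      (fun k => (lp.norm_truncate_le hp0 _ _).trans (hyC (φ k))) a.support a
    have h3 := norm_sub_norm_le (∑ k ∈ a.support, a k • y (φ k))
      (∑ k ∈ a.support, a k • lp.truncate (Finset.Ico (N k) (N (k + 1))) (y (φ k)))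
    simp only [Function.comp_apply] at h2 ⊢
    linarith
  · have h1 := norm_sum_smul_sub_le hq0 a.support a hw (hes _)
    have h2 := lp.le_norm_sum_smul_of_disjoint hq0
      (lp.truncate_Ico_disjoint hN (fun k => T (y (φ k)))) (by positivity)
      hwδ a.support a
    have h3 := norm_sub_norm_le
      (∑ k ∈ a.support, a k • lp.truncate (Finset.Ico (N k) (N (k + 1))) (T (y (φ k))))
      (∑ k ∈ a.support, a k • T (y (φ k)))
    rw [norm_sub_rev] at h3
    have h4 := Finset.rpow_sum_rpow_antitone hq0 (ENNReal.toReal_mono hp hqp) a.support a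
    simp only [Function.comp_apply]
    have h5 := mul_le_mul_of_nonneg_left h4 (half_pos hδ).le
    linarith

theorem lp.exists_subseq_tendsto_coord {p : ℝ≥0∞} [Fact (1 ≤ p)] {x : ℕ → lp (fun _ : ℕ => ℝ) p}
    {C : ℝ} (hx : ∀ n, ‖x n‖ ≤ C) :
    ∃ (φ : ℕ → ℕ) (g : ℕ → ℝ), StrictMono φ ∧ ∀ i, Tendsto (fun n => x (φ n) i) atTop (𝓝 (g i)) := by
  have hK : IsCompact (Set.univ.pi fun _ : ℕ => Set.Icc (-C) C) :=
    isCompact_univ_pi fun _ => isCompact_Icc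
  obtain ⟨g, -, φ, hφ, h⟩ := hK.tendsto_subseq (x := fun n => (x n : ℕ → ℝ)) fun n i _ =>
    abs_le.1 ((lp.norm_apply_le_norm (zero_lt_one.trans_le Fact.out).ne' (x n) i).trans (hx n))
  exact ⟨φ, g, hφ, fun i => (tendsto_pi_nhds.1 h) i⟩

theorem isCompactOperator_of_exists_cauchySeq {E F : Type*} [NormedAddCommGroup E]
    [NormedSpace ℝ E] [NormedAddCommGroup F] [NormedSpace ℝ F] [CompleteSpace F] (T : E →L[ℝ] F)
    (h : ∀ x : ℕ → E, (∀ n, ‖x n‖ ≤ 1) →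
      ∃ φ : ℕ → ℕ, StrictMono φ ∧ CauchySeq fun n => T (x (φ n))) : IsCompactOperator T := by
  refine (isCompactOperator_iff_isCompact_closure_image_closedBall (𝕜₁ := ℝ)
    (T : E →ₗ[ℝ] F) one_pos).2 (IsSeqCompact.isCompact fun z hz => ?_)
  have hx : ∀ n, ∃ x : E, ‖x‖ ≤ 1 ∧ dist (z n) (T x) < 1 / ((n : ℝ) + 1) := fun n => by
    obtain ⟨_, ⟨x, hx, rfl⟩, hd⟩ := Metric.mem_closure_iff.1 (hz n) _ Nat.one_div_pos_of_nat
    exact ⟨x, by simpa using hx, hd⟩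
  choose x hx1 hxd using hx
  obtain ⟨φ, hφ, hc⟩ := h x hx1
  obtain ⟨b, hb⟩ := cauchySeq_tendsto_of_complete hc
  have hzb : Tendsto (z ∘ φ) atTop (𝓝 b) := by
    refine (tendsto_iff_of_dist ?_).2 hb
    exact squeeze_zero (fun _ => dist_nonneg) (fun n => (hxd (φ n)).le)
      (tendsto_one_div_add_atTop_nhds_zero_nat.comp hφ.tendsto_atTop)
  exact ⟨b, isClosed_closure.mem_of_tendsto hzb (Eventually.of_forall fun n => hz _), φ, hφ, hzb⟩

/-- A strictly singular operator from `ℓ_p` to `ℓ_q` with `q ≤ p < ∞` is compact. -/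
theorem StrictlySingular.isCompactOperator_lp {p q : ℝ≥0∞} [Fact (1 ≤ p)] [Fact (1 ≤ q)]
    (hp : p ≠ ⊤) (hqp : q ≤ p)
    {T : lp (fun _ : ℕ => ℝ) p →L[ℝ] lp (fun _ : ℕ => ℝ) q} (hT : StrictlySingular T) :
    IsCompactOperator T := by
  refine isCompactOperator_of_exists_cauchySeq T fun x hx => ?_
  obtain ⟨φ, g, hφ, hg⟩ := lp.exists_subseq_tendsto_coord hx
  obtain ⟨ψ, g', hψ, hg'⟩ := lp.exists_subseq_tendsto_coord (x := fun n => T (x (φ n)))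
    (fun n => (T.le_opNorm_of_le (hx (φ n))))
  refine ⟨φ ∘ ψ, hφ.comp hψ, ?_⟩
  by_contra hC
  rw [Metric.cauchySeq_iff] at hC
  push Not at hC
  obtain ⟨δ, hδ, h⟩ := hC
  choose a ha b hb hab using h
  have ha' : Tendsto a atTop atTop := tendsto_atTop_mono ha tendsto_id
  have hb' : Tendsto b atTop atTop := tendsto_atTop_mono hb tendsto_id
  refine hT.not_coordinatewise_null hp hqp hδ (C := 1 + 1)
    (y := fun n => x (φ (ψ (a n))) - x (φ (ψ (b n))))
    (fun n => (norm_sub_le _ _).trans (add_le_add (hx _) (hx _)))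
    (fun n => ?_) (fun i => ?_) (fun i => ?_)
  · rw [map_sub, ← dist_eq_norm]
    exact hab n
  · have h := ((hg i).comp (hψ.tendsto_atTop.comp ha')).sub
      ((hg i).comp (hψ.tendsto_atTop.comp hb'))
    rw [sub_self] at h
    exact h
  · have h := ((hg' i).comp ha').sub ((hg' i).comp hb')
    rw [sub_self] at h
    simp only [map_sub]
    exact h

theorem StrictlySingular.comp_isometry {E F G H : Type*} [NormedAddCommGroup E]
    [NormedSpace ℝ E] [NormedAddCommGroup F] [NormedSpace ℝ F] [NormedAddCommGroup G]
    [NormedSpace ℝ G] [NormedAddCommGroup H] [NormedSpace ℝ H] {T : F →L[ℝ] G}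
    (hT : StrictlySingular T) (J : E →L[ℝ] F) (hJ : ∀ x, ‖J x‖ = ‖x‖) (P : G →L[ℝ] H)
    (hP : ∀ x, ‖P x‖ ≤ ‖x‖) : StrictlySingular (P ∘L T ∘L J) := by
  intro M hM c hc
  have hinj : Function.Injective J := by
    refine (injective_iff_map_eq_zero J).2 fun x hx => ?_
    rw [← norm_eq_zero, ← hJ, hx, norm_zero]
  have hM' : ¬ FiniteDimensional ℝ (M.map (J : E →ₗ[ℝ] F)) := fun h =>
    hM (LinearEquiv.finiteDimensional (M.equivMapOfInjective (J : E →ₗ[ℝ] F) hinj).symm)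
  obtain ⟨_, ⟨x, hx, rfl⟩, h⟩ := hT _ hM' c hc
  refine ⟨x, hx, (hP _).trans_lt ?_⟩
  rw [ContinuousLinearMap.coe_coe, hJ] at h
  exact h

theorem StrictlySingular.entry {m : ℕ} (X : Fin m → Type*)
    [∀ j, NormedAddCommGroup (X j)] [∀ j, NormedSpace ℝ (X j)]
    {T : (∀ j, X j) →L[ℝ] (∀ j, X j)} (hT : StrictlySingular T) (i j : Fin m) :
    StrictlySingular (ContinuousLinearMap.proj i ∘L T ∘L ContinuousLinearMap.single ℝ X j) :=
  hT.comp_isometry (ContinuousLinearMap.single ℝ X j) (fun x => Pi.norm_single x)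
    (ContinuousLinearMap.proj i) (fun x => norm_le_pi_norm x i)

theorem ContinuousLinearMap.isCompactOperator_finsetSum {E F ι : Type*} [NormedAddCommGroup E]
    [NormedSpace ℝ E] [NormedAddCommGroup F] [NormedSpace ℝ F] (s : Finset ι)
    {S : ι → E →L[ℝ] F} (hS : ∀ l ∈ s, IsCompactOperator (S l)) :
    IsCompactOperator ⇑(∑ l ∈ s, S l) :=
  Submodule.sum_mem (compactOperator (RingHom.id ℝ) E F) hS

/-- `∑ l, ι_l ∘ π_l = id` on a finite product. -/
theorem ContinuousLinearMap.sum_single_comp_proj {m : ℕ} (X : Fin m → Type*)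
    [∀ j, NormedAddCommGroup (X j)] [∀ j, NormedSpace ℝ (X j)] :
    ∑ l, ContinuousLinearMap.single ℝ X l ∘L ContinuousLinearMap.proj l =
      ContinuousLinearMap.id ℝ (∀ j, X j) := by
  ext x i
  simp [Finset.sum_apply, Finset.sum_pi_single]

/-- A product of `k` operators whose matrix entries on and above the diagonal are compact has
compact entries above the `k`-th subdiagonal. -/
theorem isCompactOperator_entry_list_prod {m : ℕ} (X : Fin m → Type*)
    [∀ j, NormedAddCommGroup (X j)] [∀ j, NormedSpace ℝ (X j)]
    (L : List ((∀ j, X j) →L[ℝ] (∀ j, X j)))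
    (hL : ∀ T ∈ L, ∀ i j : Fin m, i ≤ j → IsCompactOperator
      ⇑(ContinuousLinearMap.proj i ∘L T ∘L ContinuousLinearMap.single ℝ X j))
    (i j : Fin m) (hij : (i : ℕ) < j + L.length) :
    IsCompactOperator
      ⇑(ContinuousLinearMap.proj i ∘L L.prod ∘L ContinuousLinearMap.single ℝ X j) := by
  induction L generalizing i with
  | nil =>
    have h : (ContinuousLinearMap.proj i ∘L (List.prod []) ∘L ContinuousLinearMap.single ℝ X j :
        X j →L[ℝ] X i) = 0 := by
      ext x
      have hne : i ≠ j := fun h => by simp [h] at hij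
      simp [hne]
    rw [h]
    exact isCompactOperator_zero
  | cons T L ih =>
    have h : (ContinuousLinearMap.proj i ∘L (T :: L).prod ∘L ContinuousLinearMap.single ℝ X j :
        X j →L[ℝ] X i) = ∑ l,
        (ContinuousLinearMap.proj i ∘L T ∘L ContinuousLinearMap.single ℝ X l) ∘L
          (ContinuousLinearMap.proj l ∘L L.prod ∘L ContinuousLinearMap.single ℝ X j) := by
      ext x
      have h1 := congrArg (fun S => T (S (L.prod (ContinuousLinearMap.single ℝ X j x))) i)
        (ContinuousLinearMap.sum_single_comp_proj X)
      simpa [map_sum, Finset.sum_apply] using h1.symm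
    rw [h]
    refine ContinuousLinearMap.isCompactOperator_finsetSum _ fun l _ => ?_
    rw [List.length_cons] at hij
    by_cases hl : (l : ℕ) < j + L.length
    · exact (ih (fun S hS => hL S (List.mem_cons_of_mem _ hS)) l hl).clm_comp
        (ContinuousLinearMap.proj i ∘L T ∘L ContinuousLinearMap.single ℝ X l)
    · exact (hL T List.mem_cons_self i l (Fin.le_def.2 (by omega))).comp_clm _

theorem isCompactOperator_of_entries {m : ℕ} (X : Fin m → Type*)
    [∀ j, NormedAddCommGroup (X j)] [∀ j, NormedSpace ℝ (X j)]
    (S : (∀ j, X j) →L[ℝ] (∀ j, X j))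
    (hS : ∀ i j : Fin m, IsCompactOperator
      ⇑(ContinuousLinearMap.proj i ∘L S ∘L ContinuousLinearMap.single ℝ X j)) :
    IsCompactOperator S := by
  have h : S = ∑ i, ∑ j, ContinuousLinearMap.single ℝ X i ∘L
      (ContinuousLinearMap.proj i ∘L S ∘L ContinuousLinearMap.single ℝ X j) ∘L
        ContinuousLinearMap.proj j := by
    conv_lhs => rw [← ContinuousLinearMap.id_comp S, ← ContinuousLinearMap.comp_id S,
      ← ContinuousLinearMap.sum_single_comp_proj X]
    simp only [ContinuousLinearMap.finsetSum_comp, ContinuousLinearMap.comp_finsetSum,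
      ContinuousLinearMap.comp_assoc]
    exact Finset.sum_comm
  rw [h]
  exact ContinuousLinearMap.isCompactOperator_finsetSum _ fun i _ =>
    ContinuousLinearMap.isCompactOperator_finsetSum _ fun j _ =>
      ((hS i j).comp_clm _).clm_comp (ContinuousLinearMap.single ℝ X i)

/-- On `X = ℓ_{p 1} ⊕ ⋯ ⊕ ℓ_{p m}` (max norm), where `1 ≤ p 1 < ⋯ < p m < ∞`, every
composition of `m` strictly singular operators is compact. -/
theorem isCompactOperator_comp_strictlySingular_directSum_lp
    (m : ℕ) (hm : 1 ≤ m) (p : Fin m → ℝ) (hp1 : ∀ j, 1 ≤ p j) (hmono : StrictMono p)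
    [∀ j, Fact (1 ≤ ENNReal.ofReal (p j))]
    (T : Fin m → ((∀ j : Fin m, lp (fun _ : ℕ => ℝ) (ENNReal.ofReal (p j))) →L[ℝ]
      (∀ j : Fin m, lp (fun _ : ℕ => ℝ) (ENNReal.ofReal (p j)))))
    (hT : ∀ i, StrictlySingular (T i)) :
    IsCompactOperator ⇑((List.ofFn T).prod) := by
  refine isCompactOperator_of_entries _ _ fun i j => ?_
  refine isCompactOperator_entry_list_prod _ _ (fun S hS i j hij => ?_) i j ?_
  · obtain ⟨k, rfl⟩ := (List.mem_ofFn' T S).1 hS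
    refine StrictlySingular.isCompactOperator_lp ENNReal.ofReal_ne_top
      (ENNReal.ofReal_le_ofReal (hmono.monotone hij)) ?_
    exact (hT k).entry _ i j
  · rw [List.length_ofFn]
    omega
end

section
/- Let m ∈ ℕ with m ≥ 1, let 1 ≤ p_1 < p_2 < ⋯ < p_m < ∞ be real numbers, and let Y = ℓ_{p_1} ⊕ ⋯ ⊕ ℓ_{p_m} ⊕ c₀ be the direct sum, normed by the maximum of the coordinate norms. Then there exist strictly singular bounded linear operators T_1, …, T_m : Y → Y whose composition T_m ∘ T_{m-1} ∘ ⋯ ∘ T_1 is not compact. -/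
open scoped ZeroAtInfty

namespace ZeroAtInftyContinuousMap

variable {α : Type*} [TopologicalSpace α]

theorem norm_apply_le_norm (f : C₀(α, ℝ)) (k : α) : ‖f k‖ ≤ ‖f‖ :=
  f.toBCF.norm_coe_le_norm k

theorem norm_le_of_forall_le {f : C₀(α, ℝ)} {C : ℝ} (hC : 0 ≤ C) (h : ∀ k, ‖f k‖ ≤ C) :
    ‖f‖ ≤ C :=
  (BoundedContinuousFunction.norm_le (f := f.toBCF) hC).2 h

theorem exists_norm_apply_eq_norm {f : C₀(α, ℝ)} (hf : f ≠ 0) : ∃ k, ‖f k‖ = ‖f‖ := by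
  obtain ⟨k₀, hk₀⟩ : ∃ k, f k ≠ 0 := by
    by_contra! h
    exact hf (ext h)
  have hev : ∀ᶠ k in Filter.cocompact α, ‖f k‖ ≤ ‖f k₀‖ := by
    have := (zero_at_infty f).norm
    rw [norm_zero] at this
    exact (this.eventually_lt_const (norm_pos_iff.2 hk₀)).mono fun _ h => h.le
  obtain ⟨k, hk⟩ := (map_continuous f).norm.exists_forall_ge' k₀ hev
  exact ⟨k, (norm_apply_le_norm f k).antisymm (norm_le_of_forall_le (norm_nonneg _) hk)⟩

/-- An infinite-dimensional subspace contains a nonzero function vanishing on a given finite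
set. -/
theorem exists_mem_ne_zero_vanishing (M : Submodule ℝ C₀(α, ℝ)) (hM : ¬ FiniteDimensional ℝ M)
    (A : Finset α) : ∃ y ∈ M, y ≠ 0 ∧ ∀ k ∈ A, y k = 0 := by
  by_contra! h
  let L : M →ₗ[ℝ] (A → ℝ) :=
    { toFun := fun y k => (y : C₀(α, ℝ)) k
      map_add' := fun _ _ => rfl
      map_smul' := fun _ _ => rfl }
  refine hM (FiniteDimensional.of_injective L fun y z hyz => ?_)
  by_contra hne
  obtain ⟨k, hk, hyk⟩ := h (y - z) (M.sub_mem y.2 z.2)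
    (sub_ne_zero.2 (Subtype.coe_injective.ne hne))
  exact hyk (sub_eq_zero.2 (congrFun hyz ⟨k, hk⟩))

/-- Every infinite-dimensional space of functions vanishing at infinity on a discrete space
contains norm-one functions whose norm is attained at arbitrarily many points. -/
theorem exists_norm_attained_on_card [DiscreteTopology α] (M : Submodule ℝ C₀(α, ℝ))
    (hM : ¬ FiniteDimensional ℝ M) (n : ℕ) :
    ∃ x ∈ M, ‖x‖ = 1 ∧ ∃ A : Finset α, A.card = n ∧ ∀ k ∈ A, ‖x k‖ = 1 := by
  classical
  induction n with
  | zero =>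
    obtain ⟨y, hyM, hy, -⟩ := exists_mem_ne_zero_vanishing M hM ∅
    exact ⟨‖y‖⁻¹ • y, M.smul_mem _ hyM, norm_smul_inv_norm (𝕜 := ℝ) hy, ∅, rfl, by simp⟩
  | succ n ih =>
    obtain ⟨x, hxM, hx, A, hA, hxA⟩ := ih
    obtain ⟨y, hyM, hy, hyA⟩ := exists_mem_ne_zero_vanishing M hM A
    let u : C₀(α, ℝ) :=
      { toFun := fun k => if k ∈ A then 0 else x k
        continuous_toFun := continuous_of_discreteTopology
        zero_at_infty' := by
          refine squeeze_zero_norm (fun k => ?_) (by simpa using (zero_at_infty x).norm)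
          split_ifs <;> simp }
    have huA : ∀ k ∈ A, u k = 0 := fun k hk => if_pos hk
    have hu : ∀ k ∉ A, u k = x k := fun k hk => if_neg hk
    have hu1 : ‖u‖ ≤ 1 := by
      refine norm_le_of_forall_le zero_le_one fun k => ?_
      by_cases hk : k ∈ A
      · simp [huA k hk]
      · rw [hu k hk, ← hx]
        exact norm_apply_le_norm x k
    have hy0 : 0 < ‖y‖ := norm_pos_iff.2 hy
    have hlarge : 1 ≤ ‖u + (2 / ‖y‖) • y‖ := by
      have h1 := norm_sub_norm_le ((2 / ‖y‖) • y) (-u)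
      have h2 : ‖(2 / ‖y‖) • y‖ = 2 := by
        rw [norm_smul, Real.norm_of_nonneg (by positivity), div_mul_cancel₀ _ hy0.ne']
      rw [norm_neg, h2, sub_neg_eq_add, add_comm] at h1
      linarith
    obtain ⟨t, -, ht⟩ : (1 : ℝ) ∈ (fun t : ℝ => ‖u + t • y‖) '' Set.Icc 0 (2 / ‖y‖) :=
      intermediate_value_Icc (by positivity)
        (continuous_const.add (continuous_id.smul continuous_const)).norm.continuousOn
        ⟨by simpa using hu1, hlarge⟩
    replace ht : ‖u + t • y‖ = 1 := ht
    obtain ⟨k, hk⟩ := exists_norm_apply_eq_norm (f := u + t • y)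
      (norm_pos_iff.1 (by rw [ht]; exact one_pos))
    have hkA : k ∉ A := fun h => by
      rw [ht] at hk
      simp [huA k h, hyA k h] at hk
    have hon : ∀ j ∈ A, ‖(x + t • y) j‖ = 1 := fun j hj => by simpa [hyA j hj] using hxA j hj
    have hoff : ∀ j ∉ A, (x + t • y) j = (u + t • y) j := fun j hj => by simp [hu j hj]
    have hk1 : ‖(x + t • y) k‖ = 1 := by rw [hoff k hkA, hk, ht]
    refine ⟨x + t • y, M.add_mem hxM (M.smul_mem _ hyM), le_antisymm ?_ ?_, insert k A, ?_, ?_⟩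
    · refine norm_le_of_forall_le zero_le_one fun j => ?_
      by_cases hj : j ∈ A
      · exact (hon j hj).le
      · rw [hoff j hj, ← ht]
        exact norm_apply_le_norm _ j
    · rw [← hk1]
      exact norm_apply_le_norm _ k
    · rw [Finset.card_insert_of_notMem hkA, hA]
    · exact (Finset.forall_mem_insert _ _ _).2 ⟨hk1, hon⟩

end ZeroAtInftyContinuousMap

namespace lp

variable {p q : ENNReal} [Fact (1 ≤ p)] [Fact (1 ≤ q)]

theorem toReal_pos_of_one_le (hp : p ≠ ⊤) : 0 < p.toReal :=
  ENNReal.toReal_pos (zero_lt_one.trans_le Fact.out).ne' hp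

theorem tendsto_cocompact_zero (hp : p ≠ ⊤) (x : lp (fun _ : ℕ => ℝ) p) :
    Filter.Tendsto (⇑x) (Filter.cocompact ℕ) (nhds 0) := by
  have hp0 := toReal_pos_of_one_le hp
  rw [Filter.cocompact_eq_cofinite]
  have h := (hasSum_norm hp0 x).summable.tendsto_cofinite_zero.rpow_const
    (p := p.toReal⁻¹) (Or.inr (by positivity))
  rw [Real.zero_rpow (by positivity)] at h
  refine tendsto_zero_iff_norm_tendsto_zero.2 (h.congr fun k => ?_)
  rw [Real.rpow_rpow_inv (norm_nonneg _) hp0.ne']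

/-- The inclusion of `ℓ_p` into `c₀`, for finite `p`. -/
noncomputable def toZeroAtInfty (hp : p ≠ ⊤) : lp (fun _ : ℕ => ℝ) p →L[ℝ] C₀(ℕ, ℝ) :=
  LinearMap.mkContinuous
    { toFun := fun x => ⟨⟨x, continuous_of_discreteTopology⟩, tendsto_cocompact_zero hp x⟩
      map_add' := fun _ _ => rfl
      map_smul' := fun _ _ => rfl } 1 fun x => by
    rw [one_mul]
    exact ZeroAtInftyContinuousMap.norm_le_of_forall_le (norm_nonneg _)
      (norm_apply_le_norm (zero_lt_one.trans_le Fact.out).ne' x)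

theorem toZeroAtInfty_apply (hp : p ≠ ⊤) (x : lp (fun _ : ℕ => ℝ) p) (k : ℕ) :
    toZeroAtInfty hp x k = x k :=
  rfl

theorem toZeroAtInfty_injective (hp : p ≠ ⊤) :
    Function.Injective (toZeroAtInfty hp) := fun _ _ h =>
  lp.ext (funext fun k => DFunLike.congr_fun h k)

theorem strictlySingular_toZeroAtInfty (hp : p ≠ ⊤) : StrictlySingular (toZeroAtInfty hp) := by
  intro M hM c hc
  have hp0 := toReal_pos_of_one_le hp
  let N : Submodule ℝ C₀(ℕ, ℝ) := M.map (toZeroAtInfty hp : _ →ₗ[ℝ] C₀(ℕ, ℝ))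
  have hN : ¬ FiniteDimensional ℝ N := fun _ =>
    hM (Module.Finite.equiv (M.equivMapOfInjective (toZeroAtInfty hp : _ →ₗ[ℝ] C₀(ℕ, ℝ))
      (toZeroAtInfty_injective hp)).symm)
  obtain ⟨n, hn⟩ := exists_nat_gt (c⁻¹ ^ p.toReal)
  obtain ⟨_, ⟨x, hxM, rfl⟩, hx, A, hA, hxA⟩ :=
    ZeroAtInftyContinuousMap.exists_norm_attained_on_card N hN n
  refine ⟨x, hxM, ?_⟩
  have hsum : (n : ℝ) ≤ ‖x‖ ^ p.toReal := by
    refine le_trans (le_of_eq ?_) (sum_rpow_le_norm_rpow hp0 x A)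
    rw [Finset.sum_congr rfl fun k hk => by rw [show ‖x k‖ = 1 from hxA k hk, Real.one_rpow]]
    simp [hA]
  have hlt : c⁻¹ < ‖x‖ :=
    (Real.rpow_lt_rpow_iff (by positivity) (norm_nonneg _) hp0).1 (hn.trans_le hsum)
  change ‖toZeroAtInfty hp x‖ = 1 at hx
  rw [hx]
  exact (inv_lt_iff_one_lt_mul₀' hc).1 hlt

theorem norm_linearMapOfLE_rpow_le (hp : p ≠ ⊤) (hq : q ≠ ⊤) (hpq : p ≤ q)
    (x : lp (fun _ : ℕ => ℝ) p) {s : ℝ} (hs : ∀ k, ‖x k‖ ≤ s) :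
    ‖linearMapOfLE ℝ (fun _ : ℕ => ℝ) hpq x‖ ^ q.toReal ≤
      s ^ (q.toReal - p.toReal) * ‖x‖ ^ p.toReal := by
  have hp0 := toReal_pos_of_one_le hp
  have hq0 := toReal_pos_of_one_le hq
  have hle := ENNReal.toReal_mono hq hpq
  refine hasSum_le (fun k => ?_) (hasSum_norm hq0 (linearMapOfLE ℝ (fun _ : ℕ => ℝ) hpq x))
    ((hasSum_norm hp0 x).mul_left _)
  rw [coe_linearMapOfLE_apply]
  calc ‖x k‖ ^ q.toReal = ‖x k‖ ^ (q.toReal - p.toReal) * ‖x k‖ ^ p.toReal := by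
        rw [← Real.rpow_add_of_nonneg (norm_nonneg _) (sub_nonneg.2 hle) hp0.le, sub_add_cancel]
    _ ≤ _ := by
        gcongr
        exact hs k

theorem norm_linearMapOfLE_le (hp : p ≠ ⊤) (hq : q ≠ ⊤) (hpq : p ≤ q)
    (x : lp (fun _ : ℕ => ℝ) p) : ‖linearMapOfLE ℝ (fun _ : ℕ => ℝ) hpq x‖ ≤ ‖x‖ := by
  have hp0 := toReal_pos_of_one_le hp
  have hle := ENNReal.toReal_mono hq hpq
  have h := norm_linearMapOfLE_rpow_le hp hq hpq x
    (norm_apply_le_norm (zero_lt_one.trans_le Fact.out).ne' x)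
  rw [← Real.rpow_add_of_nonneg (norm_nonneg _) (sub_nonneg.2 hle) hp0.le,
    sub_add_cancel] at h
  exact (Real.rpow_le_rpow_iff (norm_nonneg _) (norm_nonneg _) (toReal_pos_of_one_le hq)).1 h

/-- The inclusion of `ℓ_p` into `ℓ_q`, for finite `p ≤ q`. -/
noncomputable def inclusionCLM (hp : p ≠ ⊤) (hq : q ≠ ⊤) (hpq : p ≤ q) :
    lp (fun _ : ℕ => ℝ) p →L[ℝ] lp (fun _ : ℕ => ℝ) q :=
  (linearMapOfLE ℝ (fun _ : ℕ => ℝ) hpq).mkContinuous 1 fun x => by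
    simpa using norm_linearMapOfLE_le hp hq hpq x

theorem inclusionCLM_single (hp : p ≠ ⊤) (hq : q ≠ ⊤) (hpq : p ≤ q) (k : ℕ) (a : ℝ) :
    inclusionCLM hp hq hpq (lp.single p k a) = lp.single q k a :=
  rfl

theorem strictlySingular_inclusionCLM (hp : p ≠ ⊤) (hq : q ≠ ⊤) (hpq : p < q) :
    StrictlySingular (inclusionCLM hp hq hpq.le) := by
  intro M hM c hc
  have hp0 := toReal_pos_of_one_le hp
  have hq0 := toReal_pos_of_one_le hq
  have hlt : 0 < q.toReal - p.toReal := sub_pos.2 (ENNReal.toReal_strict_mono hq hpq)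
  set ε : ℝ := c ^ (q.toReal / (q.toReal - p.toReal)) with hε
  have hε0 : 0 < ε := Real.rpow_pos_of_pos hc _
  obtain ⟨x, hxM, hx⟩ := strictlySingular_toZeroAtInfty hp M hM ε hε0
  have hx0 : 0 < ‖x‖ := pos_of_mul_pos_right ((norm_nonneg _).trans_lt hx) hε0.le
  refine ⟨x, hxM, ?_⟩
  rw [← Real.rpow_lt_rpow_iff (norm_nonneg _) (by positivity) hq0]
  calc ‖inclusionCLM hp hq hpq.le x‖ ^ q.toReal
      ≤ ‖toZeroAtInfty hp x‖ ^ (q.toReal - p.toReal) * ‖x‖ ^ p.toReal :=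
        norm_linearMapOfLE_rpow_le hp hq hpq.le x
          (ZeroAtInftyContinuousMap.norm_apply_le_norm (toZeroAtInfty hp x))
    _ < (ε * ‖x‖) ^ (q.toReal - p.toReal) * ‖x‖ ^ p.toReal := by gcongr
    _ = (c * ‖x‖) ^ q.toReal := by
        rw [Real.mul_rpow hε0.le hx0.le, Real.mul_rpow hc.le hx0.le, mul_assoc,
          ← Real.rpow_add hx0, sub_add_cancel, hε, ← Real.rpow_mul hc.le,
          div_mul_cancel₀ _ hlt.ne']

end lp

/-- Strict singularity is preserved under composition with contractions on both sides. -/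
theorem StrictlySingular.comp_of_norm_le {E F G H : Type*}
    [NormedAddCommGroup E] [NormedSpace ℝ E] [NormedAddCommGroup F] [NormedSpace ℝ F]
    [NormedAddCommGroup G] [NormedSpace ℝ G] [NormedAddCommGroup H] [NormedSpace ℝ H]
    {T : F →L[ℝ] G} (hT : StrictlySingular T) {P : E →L[ℝ] F} {J : G →L[ℝ] H}
    (hP : ∀ x, ‖P x‖ ≤ ‖x‖) (hJ : ∀ x, ‖J x‖ ≤ ‖x‖) : StrictlySingular (J ∘L T ∘L P) := by
  intro M hM c hc
  by_cases h : ∃ x ∈ M, x ≠ 0 ∧ P x = 0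
  · obtain ⟨x, hxM, hx, hPx⟩ := h
    exact ⟨x, hxM, by simpa [hPx] using mul_pos hc (norm_pos_iff.2 hx)⟩
  · push Not at h
    have hinj : Function.Injective ((P : E →ₗ[ℝ] F).submoduleMap M) := by
      rw [← LinearMap.ker_eq_bot, LinearMap.ker_eq_bot']
      intro x hx
      by_contra hne
      exact h x x.2 (by simpa using hne) (congrArg Subtype.val hx)
    have hN : ¬ FiniteDimensional ℝ (M.map (P : E →ₗ[ℝ] F)) := fun _ =>
      hM (FiniteDimensional.of_injective _ hinj)
    obtain ⟨_, ⟨x, hxM, rfl⟩, hx⟩ := hT _ hN c hc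
    exact ⟨x, hxM, ((hJ _).trans_lt hx).trans_le (by gcongr; exact hP x)⟩

theorem List.prod_ofFn_apply_of_shift {E : Type*} [AddCommGroup E] [Module ℝ E]
    [TopologicalSpace E] (e : ℕ → E) (n : ℕ) (T : Fin n → E →L[ℝ] E)
    (h : ∀ i : Fin n, T i (e (i.rev : ℕ)) = e (i.rev + 1)) :
    (List.ofFn T).prod (e 0) = e n := by
  induction n with
  | zero => simp
  | succ n ih =>
    rw [List.ofFn_succ, List.prod_cons, mul_apply_eq_comp, ih (fun i => T i.succ)]
    · simpa using h 0
    · intro i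
      simpa [Fin.rev_succ] using h i.succ

/-- An operator sending a bounded sequence to a sequence separated by a continuous map is not
compact. -/
theorem not_isCompactOperator_of_separated {E F G : Type*}
    [NormedAddCommGroup E] [NormedSpace ℝ E] [NormedAddCommGroup F] [NormedSpace ℝ F]
    [NormedAddCommGroup G] [NormedSpace ℝ G] (T : E →L[ℝ] F) (P : F →L[ℝ] G) (x : ℕ → E)
    {r δ : ℝ} (hδ : 0 < δ) (hx : ∀ k, ‖x k‖ ≤ r)
    (hsep : ∀ k l, k ≠ l → δ ≤ dist (P (T (x k))) (P (T (x l)))) : ¬ IsCompactOperator ⇑T := by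
  intro hT
  obtain ⟨y, -, φ, hφ, hlim⟩ :=
    (IsCompactOperator.isCompact_closure_image_closedBall (f := (T : E →ₗ[ℝ] F)) hT
      r).tendsto_subseq (x := fun k => T (x k))
      fun k => subset_closure ⟨x k, by simpa using hx k, rfl⟩
  obtain ⟨N, hN⟩ := Metric.cauchySeq_iff.1 ((P.continuous.tendsto y).comp hlim).cauchySeq δ hδ
  exact (hN N le_rfl (N + 1) N.le_succ).not_ge
    (hsep _ _ (hφ.injective.ne N.lt_succ_self.ne))

section DirectSum

variable {m : ℕ} (p : Fin m → ENNReal) [∀ j, Fact (1 ≤ p j)]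

/-- The direct sum `ℓ_{p 1} ⊕ ⋯ ⊕ ℓ_{p m} ⊕ c₀`. -/
abbrev DirectSumLpC0 : Type :=
  (∀ j : Fin m, lp (fun _ : ℕ => ℝ) (p j)) × C₀(ℕ, ℝ)

/-- The inclusion of the `j`-th summand into the next one, extended by zero to an operator on the
direct sum. -/
noncomputable def shiftOperator (hp : ∀ j, p j ≠ ⊤) (hmono : StrictMono p) (j : Fin m) :
    DirectSumLpC0 p →L[ℝ] DirectSumLpC0 p :=
  if h : (j : ℕ) + 1 < m then
    (ContinuousLinearMap.inl ℝ _ C₀(ℕ, ℝ) ∘L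
      ContinuousLinearMap.single ℝ (fun j : Fin m => lp (fun _ : ℕ => ℝ) (p j)) ⟨j + 1, h⟩) ∘L
    lp.inclusionCLM (hp j) (hp ⟨j + 1, h⟩) (hmono.monotone (Nat.le_succ (j : ℕ))) ∘L
    (ContinuousLinearMap.proj j ∘L ContinuousLinearMap.fst ℝ _ C₀(ℕ, ℝ))
  else
    ContinuousLinearMap.inr ℝ (∀ j : Fin m, lp (fun _ : ℕ => ℝ) (p j)) C₀(ℕ, ℝ) ∘L
    lp.toZeroAtInfty (hp j) ∘L
    (ContinuousLinearMap.proj j ∘L ContinuousLinearMap.fst ℝ _ C₀(ℕ, ℝ))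

theorem strictlySingular_shiftOperator (hp : ∀ j, p j ≠ ⊤) (hmono : StrictMono p) (j : Fin m) :
    StrictlySingular (shiftOperator p hp hmono j) := by
  have hproj : ∀ x : DirectSumLpC0 p,
      ‖((ContinuousLinearMap.proj (R := ℝ) (φ := fun j : Fin m => lp (fun _ : ℕ => ℝ) (p j)) j) ∘L
        ContinuousLinearMap.fst ℝ _ C₀(ℕ, ℝ)) x‖ ≤ ‖x‖ := fun x =>
    (norm_le_pi_norm x.1 j).trans (norm_fst_le x)
  unfold shiftOperator
  split_ifs with h
  · refine (lp.strictlySingular_inclusionCLM (hp j) (hp ⟨j + 1, h⟩)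
      (hmono (Nat.lt_succ_self (j : ℕ)))).comp_of_norm_le hproj fun x => ?_
    simp [Prod.norm_def, Pi.norm_single]
  · exact (lp.strictlySingular_toZeroAtInfty (hp j)).comp_of_norm_le hproj fun x => by
      simp [Prod.norm_def]

/-- The `k`-th unit vector of the `j`-th summand; all indices `j ≥ m` stand for the summand
`c₀`. -/
noncomputable def unitVector (hp : ∀ j, p j ≠ ⊤) (hm : 0 < m) (k j : ℕ) : DirectSumLpC0 p :=
  if h : j < m then (Pi.single ⟨j, h⟩ (lp.single (p ⟨j, h⟩) k 1), 0)
  else (0, lp.toZeroAtInfty (hp ⟨0, hm⟩) (lp.single (p ⟨0, hm⟩) k 1))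

theorem shiftOperator_unitVector (hp : ∀ j, p j ≠ ⊤) (hmono : StrictMono p) (hm : 0 < m) (k : ℕ)
    (j : Fin m) :
    shiftOperator p hp hmono j (unitVector p hp hm k j) = unitVector p hp hm k (j + 1) := by
  unfold shiftOperator unitVector
  rw [dif_pos j.2]
  split_ifs with h
  · simp [lp.inclusionCLM_single]
  · simp
    rfl

theorem dist_unitVector_snd (hp : ∀ j, p j ≠ ⊤) (hm : 0 < m) {k l : ℕ} (hkl : k ≠ l) :
    1 ≤ dist (unitVector p hp hm k m).2 (unitVector p hp hm l m).2 := by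
  rw [dist_eq_norm]
  refine le_trans (le_of_eq ?_) (ZeroAtInftyContinuousMap.norm_apply_le_norm _ k)
  simp [unitVector, lp.toZeroAtInfty_apply, hkl]

theorem norm_unitVector_zero (hp : ∀ j, p j ≠ ⊤) (hm : 0 < m) (k : ℕ) :
    ‖unitVector p hp hm k 0‖ = 1 := by
  have : 0 < p ⟨0, hm⟩ := zero_lt_one.trans_le Fact.out
  simp [unitVector, hm, Prod.norm_def, Pi.norm_single, lp.norm_single this]

end DirectSum

/-- On `Y = ℓ_{p 1} ⊕ ⋯ ⊕ ℓ_{p m} ⊕ c₀` (max norm), where `1 ≤ p 1 < ⋯ < p m < ∞`, there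
exist `m` strictly singular operators whose composition is not compact. -/
theorem exists_strictlySingular_comp_not_compact_directSum_lp_c0
    (m : ℕ) (hm : 1 ≤ m) (p : Fin m → ℝ) (hp1 : ∀ j, 1 ≤ p j) (hmono : StrictMono p)
    [∀ j, Fact (1 ≤ ENNReal.ofReal (p j))] :
    ∃ T : Fin m →
      (((∀ j : Fin m, lp (fun _ : ℕ => ℝ) (ENNReal.ofReal (p j))) × C₀(ℕ, ℝ)) →L[ℝ]
        ((∀ j : Fin m, lp (fun _ : ℕ => ℝ) (ENNReal.ofReal (p j))) × C₀(ℕ, ℝ))),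
      (∀ i, StrictlySingular (T i)) ∧ ¬ IsCompactOperator ⇑((List.ofFn T).prod) := by
  have hp : ∀ j, ENNReal.ofReal (p j) ≠ ⊤ := fun j => ENNReal.ofReal_ne_top
  have hmono' : StrictMono fun j => ENNReal.ofReal (p j) := fun i j hij =>
    (ENNReal.ofReal_lt_ofReal_iff (zero_lt_one.trans_le (hp1 j))).2 (hmono hij)
  refine ⟨fun i => shiftOperator _ hp hmono' i.rev,
    fun i => strictlySingular_shiftOperator _ hp hmono' i.rev, ?_⟩
  refine not_isCompactOperator_of_separated _ (ContinuousLinearMap.snd ℝ _ C₀(ℕ, ℝ))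
    (fun k => unitVector _ hp hm k 0) one_pos (fun k => (norm_unitVector_zero _ hp hm k).le)
    fun k l hkl => ?_
  rw [List.prod_ofFn_apply_of_shift (unitVector _ hp hm k) m _
      fun i => shiftOperator_unitVector _ hp hmono' hm k i.rev,
    List.prod_ofFn_apply_of_shift (unitVector _ hp hm l) m _
      fun i => shiftOperator_unitVector _ hp hmono' hm l i.rev]
  exact dist_unitVector_snd _ hp hm hkl
end
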